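/- arXiv:0907.2280 — 3 statements merged into one kernel-verified Lean document; each statement's English description precedes it below -/
import Mathlib

section
/- Let A be a unital C*-algebra, H and H' complex Hilbert spaces, and V : H → H' a unitary. Let ρ, σ be representations of A on H with a common unit vector Ω that is cyclic for both and satisfies ⟨Ω, ρ(x)Ω⟩ = ⟨Ω, σ(x)Ω⟩ for all x ∈ A, and let R be the unique unitary on H with R(ρ(x)Ω) = σ(x)Ω for all x ∈ A. Define representations of A on H' by ρ'(x) = V σ(x) V⁻¹ and σ'(x) = V ρ(x) V⁻¹. Then VΩ is cyclic for both ρ' and σ', the vector states of ρ' and σ' at VΩ agree, and the unique unitary R' on H' with R'(ρ'(x)(VΩ)) = σ'(x)(VΩ) for all x ∈ A satisfies R' = V R* V⁻¹; consequently R ∘ V⁻¹ ∘ R' ∘ V is the identity operator on H. -/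
open scoped InnerProductSpace
open ContinuousLinearMap

/-- **Symmetry relation for local R-matrices (equation (1.10) of Theorem 1.4(i), abstract form).**
Let `V : H → H'` be a unitary, `ρ, σ` representations of `A` on `H` with common cyclic unit
vector `Ω`, equal vector states, and `R` the unique unitary with `R (ρ x Ω) = σ x Ω`.  Define
`ρ'(x) = V σ(x) V⁻¹` and `σ'(x) = V ρ(x) V⁻¹` on `H'`.  Then `V Ω` is cyclic for `ρ'` and
`σ'`, their vector states at `V Ω` agree, and the unique unitary `R'` on `H'` with
`R' (ρ' x (V Ω)) = σ' x (V Ω)` satisfies `R' = V R* V⁻¹`; consequently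
`R ∘ V⁻¹ ∘ R' ∘ V = 1`.  (Here `V⁻¹ = V*` is the adjoint of the unitary `V`.) -/
theorem stmt4
    {A H H' : Type*}
    [NormedRing A] [StarRing A] [CStarRing A] [NormedAlgebra ℂ A] [StarModule ℂ A]
    [CompleteSpace A]
    [NormedAddCommGroup H] [InnerProductSpace ℂ H] [CompleteSpace H]
    [NormedAddCommGroup H'] [InnerProductSpace ℂ H'] [CompleteSpace H']
    (ρ σ : A →⋆ₐ[ℂ] (H →L[ℂ] H)) (Ω : H) (hΩ : ‖Ω‖ = 1)
    (hcycρ : Dense ((Submodule.span ℂ (Set.range fun x : A => ρ x Ω) : Submodule ℂ H) : Set H))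
    (hcycσ : Dense ((Submodule.span ℂ (Set.range fun x : A => σ x Ω) : Submodule ℂ H) : Set H))
    (hstate : ∀ x : A, ⟪Ω, ρ x Ω⟫_ℂ = ⟪Ω, σ x Ω⟫_ℂ)
    (R : H →L[ℂ] H) (hRu : R ∈ unitary (H →L[ℂ] H))
    (hRdef : ∀ x : A, R (ρ x Ω) = σ x Ω)
    (V : H →L[ℂ] H') (hV : Isometry V) (hVs : Function.Surjective V)
    (ρ' σ' : A →⋆ₐ[ℂ] (H' →L[ℂ] H'))
    (hρ' : ∀ x : A, ρ' x = V ∘L (σ x) ∘L (adjoint V))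
    (hσ' : ∀ x : A, σ' x = V ∘L (ρ x) ∘L (adjoint V)) :
    Dense ((Submodule.span ℂ (Set.range fun x : A => ρ' x (V Ω)) : Submodule ℂ H') : Set H') ∧
    Dense ((Submodule.span ℂ (Set.range fun x : A => σ' x (V Ω)) : Submodule ℂ H') : Set H') ∧
    (∀ x : A, ⟪V Ω, ρ' x (V Ω)⟫_ℂ = ⟪V Ω, σ' x (V Ω)⟫_ℂ) ∧
    ∀ R' : H' →L[ℂ] H', R' ∈ unitary (H' →L[ℂ] H') →
      (∀ x : A, R' (ρ' x (V Ω)) = σ' x (V Ω)) →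
        R' = V ∘L (star R) ∘L (adjoint V) ∧
        R ∘L (adjoint V) ∘L R' ∘L V = ContinuousLinearMap.id ℂ H := by
  have hin : ∀ a b : H, ⟪V a, V b⟫_ℂ = ⟪a, b⟫_ℂ := by
    have hn : ∀ x, ‖V x‖ = ‖x‖ := fun x => by
      have := hV.dist_eq x 0
      simpa using this
    intro a b
    exact LinearIsometry.inner_map_map (⟨V.toLinearMap, hn⟩ : H →ₗᵢ[ℂ] H') a b
  have hVV : ∀ a : H, adjoint V (V a) = a := by
    intro a
    refine ext_inner_right ℂ fun b => ?_
    rw [adjoint_inner_left, hin]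
  have hVV' : ∀ b : H', V (adjoint V b) = b := by
    intro b
    obtain ⟨a, rfl⟩ := hVs b
    rw [hVV]
  have hRR : ∀ a : H, star R (R a) = a := fun a => by
    have := congrArg (fun T : H →L[ℂ] H => T a) (Unitary.mem_iff.1 hRu).1
    simpa using this
  have hRR' : ∀ a : H, R (star R a) = a := fun a => by
    have := congrArg (fun T : H →L[ℂ] H => T a) (Unitary.mem_iff.1 hRu).2
    simpa using this
  have hρ1 : ∀ x, ρ' x (V Ω) = V (σ x Ω) := fun x => by
    rw [hρ']; simp [hVV]
  have hσ1 : ∀ x, σ' x (V Ω) = V (ρ x Ω) := fun x => by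
    rw [hσ']; simp [hVV]
  have key : ∀ f : A → H, Dense ((Submodule.span ℂ (Set.range f) : Submodule ℂ H) : Set H) →
      Dense ((Submodule.span ℂ (Set.range fun x => V (f x)) : Submodule ℂ H') : Set H') := by
    intro f hf
    have h1 : (Set.range fun x => V (f x)) = V.toLinearMap '' Set.range f := by
      rw [← Set.range_comp]; rfl
    rw [h1, Submodule.span_image]
    have := hVs.denseRange.dense_image V.continuous hf
    simpa using this
  have hd : Dense ((Submodule.span ℂ (Set.range fun x : A => ρ' x (V Ω)) : Submodule ℂ H') :
      Set H') := by
    simp only [hρ1]; exact key _ hcycσ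
  refine ⟨hd, ?_, ?_, ?_⟩
  · simp only [hσ1]; exact key _ hcycρ
  · intro x
    rw [hρ1, hσ1, hin, hin, hstate]
  · intro R' _ hR'
    have h : R' = V ∘L (star R) ∘L (adjoint V) := by
      refine ContinuousLinearMap.ext_on hd ?_
      rintro _ ⟨x, rfl⟩
      change R' (ρ' x (V Ω)) = V (star R (adjoint V (ρ' x (V Ω))))
      rw [hR', hρ1, hσ1, hVV, ← hRdef, hRR]
    refine ⟨h, ?_⟩
    ext a
    rw [h]
    change R (adjoint V (V (star R (adjoint V (V a))))) = a
    rw [hVV, hVV, hRR']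
end

section
/- Let n, m ≥ 1, let S_a^{(nm)} (1 ≤ a ≤ nm) be the operators on ℓ²(ℕ) with S_a^{(nm)} e_k = e_{nm(k−1)+a}, and let U_a = A_i^{(n)} B_j^{(m)} (a = m(i−1)+j) be the composed Cuntz family on ℓ²(ℕ×ℕ). Then for all p, q ≥ 0 and all indices a₁,…,a_p, b₁,…,b_q ∈ {1,…,nm}: ⟨e_{(1,1)}, U_{a₁}⋯U_{a_p} (U_{b_q})*⋯(U_{b₁})* e_{(1,1)}⟩ = ⟨e₁, S_{a₁}^{(nm)}⋯S_{a_p}^{(nm)} (S_{b_q}^{(nm)})*⋯(S_{b₁}^{(nm)})* e₁⟩. -/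
open scoped InnerProductSpace
open ContinuousLinearMap

/-- The Hilbert space `ℓ²(ℕ)`. -/
noncomputable abbrev l2N : Type := lp (fun _ : ℕ => ℂ) 2

/-- The standard orthonormal basis vector `e_k` of `ℓ²(ℕ)` (0-based labels). -/
noncomputable def eN (k : ℕ) : l2N := lp.single 2 k 1

/-- The Hilbert space `ℓ²(ℕ × ℕ)`. -/
noncomputable abbrev l2N2 : Type := lp (fun _ : ℕ × ℕ => ℂ) 2

/-- The standard orthonormal basis vector `e_{(k,l)}` of `ℓ²(ℕ × ℕ)` (0-based labels). -/
noncomputable def eN2 (k l : ℕ) : l2N2 := lp.single 2 (k, l) 1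

/-- The index `m (i - 1) + j` (1-based) pairing `{1,…,n} × {1,…,m}` with `{1,…,nm}`;
in 0-based labels `(i, j) ↦ m * i + j`. -/
def pairIdx {n m : ℕ} (i : Fin n) (j : Fin m) : Fin (n * m) :=
  ⟨m * (i : ℕ) + (j : ℕ), by
    have hi := i.isLt
    have hj := j.isLt
    calc m * (i : ℕ) + (j : ℕ) < m * (i : ℕ) + m := by omega
    _ = m * ((i : ℕ) + 1) := by ring
    _ ≤ m * n := Nat.mul_le_mul_left m hi
    _ = n * m := Nat.mul_comm m n⟩

theorem aux_prod {H ι : Type*} [NormedAddCommGroup H] [InnerProductSpace ℂ H] [CompleteSpace H]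
    (T : ι → H →L[ℂ] H) (c : ι → ℂ) (e : H) (h : ∀ a, star (T a) e = c a • e) (l : List ι) :
    star ((l.map T).prod) e = (l.map c).prod • e := by
  induction l with
  | nil => simp
  | cons a l ih =>
    rw [List.map_cons, List.prod_cons, star_mul, ContinuousLinearMap.mul_apply, h, map_smul, ih,
      smul_smul, List.map_cons, List.prod_cons]

theorem aux_inner {H ι : Type*} [NormedAddCommGroup H] [InnerProductSpace ℂ H] [CompleteSpace H]
    (T : ι → H →L[ℂ] H) (c : ι → ℂ) (e : H) (he : ⟪e, e⟫_ℂ = 1)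
    (h : ∀ a, star (T a) e = c a • e) (as bs : List ι) :
    ⟪e, ((as.map T).prod * star ((bs.map T).prod)) e⟫_ℂ
      = (starRingEnd ℂ) (as.map c).prod * (bs.map c).prod := by
  rw [ContinuousLinearMap.mul_apply, ← ContinuousLinearMap.adjoint_inner_left,
    ← ContinuousLinearMap.star_eq_adjoint, aux_prod T c e h, aux_prod T c e h,
    inner_smul_left, inner_smul_right, he, mul_one]

theorem aux_coord {α : Type*} [DecidableEq α] (T : lp (fun _ : α => ℂ) 2 →L[ℂ] lp (fun _ : α => ℂ) 2)
    (f : α → α) (z : α) (c : ℂ)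
    (hT : ∀ k, T (lp.single 2 k 1) = lp.single 2 (f k) 1)
    (hc : ∀ k, (if f k = z then (1 : ℂ) else 0) = if k = z then c else 0) :
    star T (lp.single 2 z 1) = c • (lp.single 2 z 1 : lp (fun _ : α => ℂ) 2) := by
  ext k
  have h1 : ∀ x : lp (fun _ : α => ℂ) 2, x k = ⟪(lp.single 2 k 1 : lp (fun _ : α => ℂ) 2), x⟫_ℂ := by
    intro x
    rw [lp.inner_single_left]; simp
  rw [h1, ContinuousLinearMap.star_eq_adjoint, ContinuousLinearMap.adjoint_inner_right, hT,
    lp.inner_single_left]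
  have := hc k
  simpa [Pi.single_apply] using this

theorem pair_surj {n m : ℕ} (a : Fin (n * m)) : ∃ (i : Fin n) (j : Fin m), a = pairIdx i j := by
  have hm : 0 < m := by
    rcases Nat.eq_zero_or_pos m with h | h
    · subst h; exact absurd a.isLt (by simp)
    · exact h
  refine ⟨⟨a / m, ?_⟩, ⟨a % m, Nat.mod_lt _ hm⟩, ?_⟩
  · exact (Nat.div_lt_iff_lt_mul hm).2 a.isLt
  · apply Fin.ext
    simp [pairIdx, Nat.div_add_mod]

/-- **The state identity `ω_n ⋆ ω_m = ω_{nm}` (Theorem 3.4(i) for `ϱ_{e₁}`).**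
For all words, the vector state of the composed family `U_a = A_i B_j` at `e_{(1,1)}` agrees
with the vector state of `S^{(nm)}` at `e₁`:
`⟨e_{(1,1)}, U_{a₁}⋯U_{a_p} U_{b_q}*⋯U_{b₁}* e_{(1,1)}⟩
  = ⟨e₁, S_{a₁}⋯S_{a_p} S_{b_q}*⋯S_{b₁}* e₁⟩`
(note `U_{b_q}*⋯U_{b₁}* = (U_{b₁}⋯U_{b_q})*`). -/
theorem stmt11 {n m : ℕ} (hn : 1 ≤ n) (hm : 1 ≤ m)
    (S : Fin (n * m) → l2N →L[ℂ] l2N)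
    (hS : ∀ (a : Fin (n * m)) (k : ℕ), S a (eN k) = eN (n * m * k + a))
    (A : Fin n → l2N2 →L[ℂ] l2N2)
    (hA : ∀ (i : Fin n) (k l : ℕ), A i (eN2 k l) = eN2 (n * k + i) l)
    (B : Fin m → l2N2 →L[ℂ] l2N2)
    (hB : ∀ (j : Fin m) (k l : ℕ), B j (eN2 k l) = eN2 k (m * l + j))
    (U : Fin (n * m) → l2N2 →L[ℂ] l2N2)
    (hU : ∀ (i : Fin n) (j : Fin m), U (pairIdx i j) = (A i) ∘L (B j)) :
    ∀ as bs : List (Fin (n * m)),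
      ⟪eN2 0 0, ((as.map U).prod * star ((bs.map U).prod)) (eN2 0 0)⟫_ℂ =
        ⟪eN 0, ((as.map S).prod * star ((bs.map S).prod)) (eN 0)⟫_ℂ := by
  intro as bs
  have hn0 : n ≠ 0 := by omega
  have hm0 : m ≠ 0 := by omega
  rw [aux_inner S (fun a => if (a : ℕ) = 0 then 1 else 0) (eN 0),
    aux_inner U (fun a => if (a : ℕ) = 0 then 1 else 0) (eN2 0 0)]
  · rw [eN2, lp.inner_single_left]; simp
  · intro a
    obtain ⟨i, j, rfl⟩ := pair_surj a
    refine aux_coord _ (fun k => (n * k.1 + i, m * k.2 + j)) (0, 0) _ ?_ ?_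
    · rintro ⟨k, l⟩
      have := hA i k (m * l + j)
      rw [← hB, ← ContinuousLinearMap.comp_apply, ← hU] at this
      exact this
    · rintro ⟨k, l⟩
      simp only [Prod.mk.injEq, pairIdx, Nat.add_eq_zero_iff, mul_eq_zero, hn0, hm0, false_or]
      split_ifs <;> first | rfl | (exfalso; tauto)
  · rw [eN, lp.inner_single_left]; simp
  · intro a
    refine aux_coord _ (fun k => n * m * k + a) 0 _ (hS a) ?_
    intro k
    simp only [Nat.add_eq_zero_iff, mul_eq_zero, hn0, hm0, false_or]
    split_ifs <;> first | rfl | (exfalso; tauto)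
end

section
/- Let R(2,3) be the unique unitary on ℓ²(ℕ×ℕ) with R(2,3) e_{(1,1)} = e_{(1,1)} and R(2,3) (A_i^{(2)} B_j^{(3)}) R(2,3)* = A_q^{(2)} B_p^{(3)} for all 1 ≤ i,q ≤ 2, 1 ≤ j,p ≤ 3 with 3(i−1)+j = 2(p−1)+q. Then R(2,3) e_{(1,3)} = e_{(1,2)}; in particular R(2,3) is not the identity operator. -/
open ContinuousLinearMap

/-- **The local R-matrix `R(ω₂, ω₃)` is nontrivial (§3.3(i)).**
Let `R(2,3)` be the unique unitary on `ℓ²(ℕ×ℕ)` with `R e_{(1,1)} = e_{(1,1)}` and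
`R (A_i B_j) R* = A_q B_p` whenever `3(i-1)+j = 2(p-1)+q` (0-based: `3 i + j = 2 p + q`),
where `A_i e_{(k,l)} = e_{(2(k-1)+i, l)}` and `B_j e_{(k,l)} = e_{(k, 3(l-1)+j)}`.
Then `R(2,3) e_{(1,3)} = e_{(1,2)}` (0-based: `R (e_{(0,2)}) = e_{(0,1)}`); in particular
`R(2,3)` is not the identity operator. -/
theorem stmt13
    (A : Fin 2 → l2N2 →L[ℂ] l2N2)
    (hA : ∀ (i : Fin 2) (k l : ℕ), A i (eN2 k l) = eN2 (2 * k + i) l)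
    (B : Fin 3 → l2N2 →L[ℂ] l2N2)
    (hB : ∀ (j : Fin 3) (k l : ℕ), B j (eN2 k l) = eN2 k (3 * l + j))
    (R : l2N2 →L[ℂ] l2N2)
    (hRu : R ∈ unitary (l2N2 →L[ℂ] l2N2))
    (hRe : R (eN2 0 0) = eN2 0 0)
    (hR : ∀ (i q : Fin 2) (j p : Fin 3),
      3 * (i : ℕ) + (j : ℕ) = 2 * (p : ℕ) + (q : ℕ) →
        R * (A i * B j) * star R = A q * B p) :
    R (eN2 0 2) = eN2 0 1 ∧ R ≠ 1 := by
  have h1 : star R (eN2 0 0) = eN2 0 0 := by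
    have h := congrArg (fun T : l2N2 →L[ℂ] l2N2 => T (eN2 0 0)) (Unitary.star_mul_self_of_mem hRu)
    change star R (R (eN2 0 0)) = eN2 0 0 at h
    rwa [hRe] at h
  have h2 : R (eN2 0 2) = eN2 0 1 := by
    have h := congrArg (fun T : l2N2 →L[ℂ] l2N2 => T (eN2 0 0)) (hR 0 0 2 1 (by decide))
    change R (A 0 (B 2 (star R (eN2 0 0)))) = A 0 (B 1 (eN2 0 0)) at h
    rw [h1, hB, hB, hA, hA] at h
    exact h
  refine ⟨h2, ?_⟩
  intro hR1
  rw [hR1] at h2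
  change eN2 0 2 = eN2 0 1 at h2
  have h3 := congrArg (fun v : l2N2 => v (0, 1)) h2
  simp [eN2, lp.single_apply] at h3
end
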